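/- arXiv:1709.04144 — 3 statements merged into one kernel-verified Lean document; each statement's English description precedes it below -/
import Mathlib

section
/- Let α, β ∈ (0,1) be real and let μ > 1 be real with μ − α − β ∉ ℤ. Then the function G_μ is differentiable on (0,1) and for every real λ ∈ (0,1) one has G_μ′(λ) = (μ−1)·G_{μ−1}(λ). -/
open Set Complex

/-- Pochhammer symbol `(a)_n` for complex `a`. -/
noncomputable def pochC (a : ℂ) (n : ℕ) : ℂ := (ascPochhammer ℂ n).eval a

/-- Gauss hypergeometric function `₂F₁(a,b;c;x)` as a series (complex version). -/
noncomputable def hyp2F1C (a b c x : ℂ) : ℂ :=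
  ∑' n : ℕ, pochC a n * pochC b n / (pochC c n * (n.factorial : ℂ)) * x ^ n

/-- `G_μ(λ) = e^{iπμ}·Γ(μ)Γ(μ+1−α−β)/(Γ(μ+1−α)Γ(μ+1−β))·₂F₁(α−μ,β−μ;α+β−μ;λ)`. -/
noncomputable def Gfun (α β μ : ℝ) : ℝ → ℂ :=
  fun x => Complex.exp (Complex.I * Real.pi * μ) *
    (Complex.Gamma (μ : ℂ) * Complex.Gamma ((μ : ℂ) + 1 - α - β) /
      (Complex.Gamma ((μ : ℂ) + 1 - α) * Complex.Gamma ((μ : ℂ) + 1 - β))) *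
    hyp2F1C ((α : ℂ) - μ) ((β : ℂ) - μ) ((α : ℂ) + β - μ) (x : ℂ)

/-- The coefficient of `x ^ n` in the series defining `hyp2F1C a b c x`. -/
noncomputable def hyp2F1Coeff (a b c : ℂ) (n : ℕ) : ℂ :=
  pochC a n * pochC b n / (pochC c n * (n.factorial : ℂ))

theorem pochC_succ_left (a : ℂ) (n : ℕ) : pochC a (n + 1) = a * pochC (a + 1) n := by
  simp [pochC, ascPochhammer_succ_left, Polynomial.eval_comp]

theorem hyp2F1Coeff_succ (a b c : ℂ) (n : ℕ) :
    ((n + 1 : ℕ) : ℂ) * hyp2F1Coeff a b c (n + 1) =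
      a * b / c * hyp2F1Coeff (a + 1) (b + 1) (c + 1) n := by
  have hn : ((n : ℂ) + 1) ≠ 0 := Nat.cast_add_one_ne_zero n
  simp only [hyp2F1Coeff, pochC_succ_left, Nat.factorial_succ, Nat.cast_mul, Nat.cast_add,
    Nat.cast_one]
  field_simp

/-- The Gauss series converges absolutely inside the unit disc. -/
theorem summable_norm_hyp2F1Coeff_mul_pow (a b : ℂ) {c : ℂ} (hc : ∀ k : ℕ, c ≠ -k)
    {r : ℝ} (hr0 : 0 ≤ r) (hr : r < 1) :
    Summable fun n ↦ ‖hyp2F1Coeff a b c n‖ * r ^ n := by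
  lift r to NNReal using hr0
  have hrad : (r : ENNReal) < (regularizedGaussHGFunSeries a b c).radius :=
    lt_of_lt_of_le (by exact_mod_cast hr) (radius_regularizedGaussHGFunSeries_ge_one a b c)
  refine (((regularizedGaussHGFunSeries a b c).summable_norm_mul_pow hrad).mul_left
    ‖Gamma c‖).congr fun n ↦ ?_
  rw [FormalMultilinearSeries.norm_apply_eq_norm_coef,
    ← Gamma_inv_mul_ordinaryHypergeometricSeries_eq hc, norm_mul, norm_inv]
  have hΓ : ‖Gamma c‖ ≠ 0 := norm_ne_zero_iff.mpr (Gamma_ne_zero hc)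
  rw [← mul_assoc, ← mul_assoc, mul_inv_cancel₀ hΓ, one_mul, ordinaryHypergeometricSeries,
    FormalMultilinearSeries.coeff_ofScalars]
  congr 2
  simp only [hyp2F1Coeff, pochC, ordinaryHypergeometricCoefficient, div_eq_mul_inv, mul_inv]
  ring

/-- The derivative of the Gauss hypergeometric function inside the unit disc. -/
theorem hasDerivAt_hyp2F1C (a b : ℂ) {c : ℂ} (hc : ∀ k : ℕ, c ≠ -k) {z : ℂ} (hz : ‖z‖ < 1) :
    HasDerivAt (hyp2F1C a b c) (a * b / c * hyp2F1C (a + 1) (b + 1) (c + 1) z) z := by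
  obtain ⟨r, hzr, hr⟩ := exists_between hz
  have hr0 : 0 < r := (norm_nonneg z).trans_lt hzr
  have hc' : ∀ k : ℕ, c + 1 ≠ -k := fun k hk ↦ hc (k + 1) (by
    push_cast
    linear_combination hk)
  have hu : Summable fun n : ℕ ↦ ‖(n : ℂ) * hyp2F1Coeff a b c n‖ * r ^ (n - 1) := by
    refine (summable_nat_add_iff 1).mp ?_
    refine ((summable_norm_hyp2F1Coeff_mul_pow (a + 1) (b + 1) hc' hr0.le hr).mul_left
      ‖a * b / c‖).congr fun n ↦ ?_
    rw [hyp2F1Coeff_succ, norm_mul, Nat.add_sub_cancel, mul_assoc]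
  have hball : ∀ w : ℂ, w ∈ Metric.ball (0 : ℂ) r ↔ ‖w‖ < r := fun w ↦ mem_ball_zero_iff
  have hbound : ∀ (n : ℕ) (w : ℂ), w ∈ Metric.ball (0 : ℂ) r →
      ‖hyp2F1Coeff a b c n * (n * w ^ (n - 1))‖ ≤
        ‖(n : ℂ) * hyp2F1Coeff a b c n‖ * r ^ (n - 1) := by
    intro n w hw
    rw [← mul_assoc, mul_comm (hyp2F1Coeff a b c n), norm_mul, norm_pow]
    gcongr
    exact ((hball w).mp hw).le
  have hd := hasDerivAt_tsum_of_isPreconnected hu Metric.isOpen_ball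
    (convex_ball (0 : ℂ) r).isPreconnected
    (fun n w _ ↦ (hasDerivAt_pow n w).const_mul (hyp2F1Coeff a b c n)) hbound
    ((hball z).mpr hzr)
    (Summable.of_norm ((summable_norm_hyp2F1Coeff_mul_pow a b hc (norm_nonneg z) hz).congr
      fun n ↦ by rw [norm_mul, norm_pow])) ((hball z).mpr hzr)
  have hsum : Summable fun n : ℕ ↦ hyp2F1Coeff a b c n * (n * z ^ (n - 1)) :=
    Summable.of_norm_bounded hu fun n ↦ hbound n z ((hball z).mpr hzr)
  refine hd.congr_deriv ?_
  rw [hsum.tsum_eq_zero_add, hyp2F1C, ← tsum_mul_left]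
  simp only [Nat.cast_zero, zero_mul, mul_zero, zero_add, Nat.add_sub_cancel]
  refine tsum_congr fun n ↦ ?_
  have h := hyp2F1Coeff_succ a b c n
  rw [hyp2F1Coeff.eq_def (a + 1)] at h
  linear_combination z ^ n * h

/-- for `α, β ∈ (0,1)`, `μ > 1` with `μ − α − β ∉ ℤ`, `G_μ` is
differentiable on `(0,1)` with `G_μ′(λ) = (μ−1)·G_{μ−1}(λ)`. -/
theorem stmt1 (α β μ : ℝ) (hα : α ∈ Ioo (0 : ℝ) 1) (hβ : β ∈ Ioo (0 : ℝ) 1)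
    (hμ : 1 < μ) (hint : ∀ k : ℤ, μ - α - β ≠ (k : ℝ)) :
    ∀ x ∈ Ioo (0 : ℝ) 1,
      HasDerivAt (Gfun α β μ) (((μ : ℂ) - 1) * Gfun α β (μ - 1) x) x := by
  intro x hx
  have hc : ∀ k : ℤ, (α : ℂ) + β - μ ≠ k := fun k hk ↦ hint (-k) (by
    have hk' : α + β - μ = k := by exact_mod_cast hk
    push_cast
    linarith)
  have hF := (hasDerivAt_hyp2F1C ((α : ℂ) - μ) ((β : ℂ) - μ) (c := (α : ℂ) + β - μ)
    (fun k ↦ by exact_mod_cast hc (-k)) (z := (x : ℂ))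
    (by rw [norm_real, Real.norm_of_nonneg hx.1.le]; exact hx.2)).comp_ofReal
  refine (hF.const_mul _).congr_deriv ?_
  have hα' : (μ : ℂ) - α ≠ 0 := by exact_mod_cast (by linarith [hα.2] : (0 : ℝ) < μ - α).ne'
  have hβ' : (μ : ℂ) - β ≠ 0 := by exact_mod_cast (by linarith [hβ.2] : (0 : ℝ) < μ - β).ne'
  have hμ' : (μ : ℂ) - 1 ≠ 0 := by exact_mod_cast (by linarith : (0 : ℝ) < μ - 1).ne'
  have hs : (μ : ℂ) - α - β ≠ 0 := fun h ↦ hc 0 (by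
    push_cast
    linear_combination -h)
  have hexp : exp (I * Real.pi * μ) = -exp (I * Real.pi * ((μ : ℂ) - 1)) := by
    rw [show I * Real.pi * (μ : ℂ) = I * Real.pi * ((μ : ℂ) - 1) + Real.pi * I by ring,
      exp_add, exp_pi_mul_I]
    ring
  have hΓ₁ : Gamma (μ : ℂ) = (μ - 1) * Gamma ((μ : ℂ) - 1) := by
    rw [← Gamma_add_one _ hμ', sub_add_cancel]
  have hΓ₂ : Gamma ((μ : ℂ) + 1 - α - β) = (μ - α - β) * Gamma ((μ : ℂ) - α - β) := by
    rw [← Gamma_add_one _ hs]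
    ring_nf
  have hΓ₃ : Gamma ((μ : ℂ) + 1 - α) = (μ - α) * Gamma ((μ : ℂ) - α) := by
    rw [← Gamma_add_one _ hα']
    ring_nf
  have hΓ₄ : Gamma ((μ : ℂ) + 1 - β) = (μ - β) * Gamma ((μ : ℂ) - β) := by
    rw [← Gamma_add_one _ hβ']
    ring_nf
  have hcoef : ((α : ℂ) - μ) * (β - μ) / (α + β - μ) =
      -((μ - α) * (μ - β) / (μ - α - β)) := by
    rw [show (α : ℂ) + β - μ = -(μ - α - β) by ring, div_neg]
    ring
  rw [hexp, hΓ₁, hΓ₂, hΓ₃, hΓ₄, hcoef]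
  simp only [Gfun, ofReal_sub, ofReal_one, sub_add_cancel]
  rw [show (α : ℂ) - μ + 1 = α - (μ - 1) by ring, show (β : ℂ) - μ + 1 = β - (μ - 1) by ring,
    show (α : ℂ) + β - μ + 1 = α + β - (μ - 1) by ring]
  field_simp
end

section
/- Let α, β ∈ (0,1) and μ > 0 be real numbers. Then F_μ is twice differentiable on (1,2) and satisfies the hypergeometric differential equation λ(1−λ)·F_μ″(λ) + (α+β−μ−(α+β−2μ+1)λ)·F_μ′(λ) − (α−μ)(β−μ)·F_μ(λ) = 0 for all real λ ∈ (1,2); that is, F_μ is a solution of the differential equation satisfied by ₂F₁(α−μ, β−μ; α+β−μ; λ). -/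
open Set

/-- Pochhammer symbol `(a)_n` for real `a`. -/
noncomputable def poch (a : ℝ) (n : ℕ) : ℝ := (ascPochhammer ℝ n).eval a

/-- Gauss hypergeometric function `₂F₁(a,b;c;x)` as a series (real version). -/
noncomputable def hyp2F1 (a b c x : ℝ) : ℝ :=
  ∑' n : ℕ, poch a n * poch b n / (poch c n * (n.factorial : ℝ)) * x ^ n

/-- `F_μ(λ) = (1/μ)·(λ−1)^μ·₂F₁(α,β;μ+1;1−λ)` (real power). -/
noncomputable def Ffun (α β μ : ℝ) : ℝ → ℝ :=
  fun x => (1 / μ) * (x - 1) ^ μ * hyp2F1 α β (μ + 1) (1 - x)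

open scoped Topology

/-- A power series with polynomially bounded coefficients converges on the unit disc. -/
lemma summable_mul_pow_of_poly_bound {a : ℕ → ℝ} {C : ℝ} {k : ℕ}
    (ha : ∀ n, |a n| ≤ C * ((n : ℝ) + 1) ^ k) {x : ℝ} (hx : |x| < 1) :
    Summable fun n : ℕ => |a n| * |x| ^ n := by
  have hC : 0 ≤ C := by simpa using (abs_nonneg _).trans (ha 0)
  have h1 : Summable fun n : ℕ => (n : ℝ) ^ k * |x| ^ n :=
    summable_pow_mul_geometric_of_norm_lt_one k (by simpa using hx)
  have h2 : Summable fun n : ℕ => |x| ^ n :=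
    summable_geometric_of_lt_one (abs_nonneg x) hx
  refine Summable.of_nonneg_of_le (fun n => by positivity) (fun n => ?_)
    ((h1.add h2).mul_left (C * 2 ^ (k - 1)))
  have h3 : ((n : ℝ) + 1) ^ k ≤ 2 ^ (k - 1) * ((n : ℝ) ^ k + 1 ^ k) :=
    add_pow_le (Nat.cast_nonneg n) zero_le_one k
  calc |a n| * |x| ^ n ≤ (C * (2 ^ (k - 1) * ((n : ℝ) ^ k + 1 ^ k))) * |x| ^ n := by
        gcongr
        exact (ha n).trans (by gcongr)
    _ = _ := by rw [one_pow]; ring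

lemma poly_bound_derivative_coeff {a : ℕ → ℝ} {C : ℝ} {k : ℕ}
    (ha : ∀ n, |a n| ≤ C * ((n : ℝ) + 1) ^ k) (n : ℕ) :
    |((n : ℝ) + 1) * a (n + 1)| ≤ (C * 2 ^ k) * ((n : ℝ) + 1) ^ (k + 1) := by
  have hC : 0 ≤ C := by simpa using (abs_nonneg _).trans (ha 0)
  have hn : (0 : ℝ) ≤ n := Nat.cast_nonneg n
  rw [abs_mul, abs_of_nonneg (by positivity : (0 : ℝ) ≤ (n : ℝ) + 1)]
  have h := ha (n + 1)
  push_cast at h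
  calc ((n : ℝ) + 1) * |a (n + 1)| ≤ ((n : ℝ) + 1) * (C * (2 * ((n : ℝ) + 1)) ^ k) := by
        gcongr
        refine h.trans ?_
        gcongr
        linarith
    _ = _ := by rw [mul_pow]; ring

lemma hasSum_mul_pow_of_poly_bound {a : ℕ → ℝ} {C : ℝ} {k : ℕ}
    (ha : ∀ n, |a n| ≤ C * ((n : ℝ) + 1) ^ k) {x : ℝ} (hx : |x| < 1) :
    HasSum (fun n => a n * x ^ n) (∑' n, a n * x ^ n) := by
  refine (Summable.of_norm ?_).hasSum
  simpa [abs_mul, abs_pow] using summable_mul_pow_of_poly_bound ha hx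

/-- Termwise differentiation on the unit disc. -/
lemma hasDerivAt_tsum_mul_pow {a : ℕ → ℝ} {C : ℝ} {k : ℕ}
    (ha : ∀ n, |a n| ≤ C * ((n : ℝ) + 1) ^ k) {x : ℝ} (hx : |x| < 1) :
    HasDerivAt (fun y => ∑' n, a n * y ^ n)
      (∑' n : ℕ, (((n : ℝ) + 1) * a (n + 1)) * x ^ n) x := by
  obtain ⟨r, hxr, hr⟩ := exists_between hx
  have hr0 : 0 < r := (abs_nonneg x).trans_lt hxr
  have hr1 : |r| < 1 := by rwa [abs_of_pos hr0]
  have hsum : Summable fun n : ℕ => |a n| * n * r ^ (n - 1) := by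
    rw [← summable_nat_add_iff 1]
    have h := summable_mul_pow_of_poly_bound (poly_bound_derivative_coeff ha) hr1
    refine h.congr fun n => ?_
    rw [abs_mul, abs_of_nonneg (by positivity : (0 : ℝ) ≤ (n : ℝ) + 1), abs_of_pos hr0]
    push_cast
    ring
  have hd := hasDerivAt_tsum_of_isPreconnected (g := fun n y => a n * y ^ n)
    (g' := fun n y => a n * (n * y ^ (n - 1))) (t := Ioo (-r) r) (y₀ := x) (y := x) hsum
    isOpen_Ioo isPreconnected_Ioo (fun n y _ => (hasDerivAt_pow n y).const_mul (a n))
    (fun n y hy => by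
      have hy' : |y| ≤ r := (abs_lt.mpr ⟨hy.1, hy.2⟩).le
      rw [Real.norm_eq_abs, abs_mul, abs_mul, abs_pow, Nat.abs_cast, mul_assoc]
      gcongr)
    (abs_lt.mp hxr) (hasSum_mul_pow_of_poly_bound ha hx).summable (abs_lt.mp hxr)
  refine hd.congr_deriv ?_
  have h := (hasSum_mul_pow_of_poly_bound (poly_bound_derivative_coeff ha) hx)
  have h' : HasSum (fun n : ℕ => a (n + 1) * (((n + 1 : ℕ) : ℝ) * x ^ (n + 1 - 1)))
      (∑' n : ℕ, (((n : ℝ) + 1) * a (n + 1)) * x ^ n) := by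
    have e : (fun n : ℕ => a (n + 1) * (((n + 1 : ℕ) : ℝ) * x ^ (n + 1 - 1))) =
        fun n : ℕ => (((n : ℝ) + 1) * a (n + 1)) * x ^ n := by
      funext n
      rw [Nat.add_sub_cancel]
      push_cast
      ring
    rwa [e]
  have h2 := (hasSum_nat_add_iff (f := fun n : ℕ => a n * (n * x ^ (n - 1))) 1).mp h'
  simpa using h2.tsum_eq

/-- Multiplying a differentiated power series by the variable. -/
lemma hasSum_natCast_mul_pow {a : ℕ → ℝ} {s x : ℝ}
    (h : HasSum (fun n : ℕ => (((n : ℝ) + 1) * a (n + 1)) * x ^ n) s) :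
    HasSum (fun n : ℕ => (n * a n) * x ^ n) (x * s) := by
  have h' : HasSum (fun n : ℕ => (((n + 1 : ℕ) : ℝ) * a (n + 1)) * x ^ (n + 1)) (x * s) := by
    have e : (fun n : ℕ => (((n + 1 : ℕ) : ℝ) * a (n + 1)) * x ^ (n + 1)) =
        fun n : ℕ => x * ((((n : ℝ) + 1) * a (n + 1)) * x ^ n) := by
      funext n
      push_cast
      ring
    rw [e]
    exact h.mul_left x
  simpa using (hasSum_nat_add_iff (f := fun n : ℕ => (n * a n) * x ^ n) 1).mp h'

lemma poch_succ (a : ℝ) (n : ℕ) : poch a (n + 1) = poch a n * (a + n) := by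
  simp [poch, ascPochhammer_succ_eval]

lemma poch_pos {a : ℝ} (ha : 0 < a) (n : ℕ) : 0 < poch a n := ascPochhammer_pos n a ha

lemma poch_le_poch {a b : ℝ} (ha : 0 < a) (hab : a ≤ b) (n : ℕ) : poch a n ≤ poch b n := by
  induction n with
  | zero => simp [poch]
  | succ n ih =>
    rw [poch_succ, poch_succ]
    have := (poch_pos (ha.trans_le hab) n).le
    gcongr

lemma poch_one (n : ℕ) : poch 1 n = n.factorial := by
  simp [poch]

/-- Coefficients of the Gauss hypergeometric series. -/
noncomputable def hypCoeff (a b c : ℝ) (n : ℕ) : ℝ :=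
  poch a n * poch b n / (poch c n * (n.factorial : ℝ))

lemma hypCoeff_succ {a b c : ℝ} (hc : 0 < c) (n : ℕ) :
    (c + n) * ((n + 1) * hypCoeff a b c (n + 1)) = (a + n) * (b + n) * hypCoeff a b c n := by
  have h1 := (poch_pos hc n).ne'
  have h2 : c + n ≠ 0 := by positivity
  have h3 : (n.factorial : ℝ) ≠ 0 := by positivity
  have h4 : (n : ℝ) + 1 ≠ 0 := by positivity
  simp only [hypCoeff, poch_succ, Nat.factorial_succ, Nat.cast_mul, Nat.cast_add, Nat.cast_one]
  field_simp

lemma abs_hypCoeff_le {a b c : ℝ} (ha : 0 < a) (ha1 : a ≤ 1) (hb : 0 < b) (hbc : b ≤ c) (n : ℕ) :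
    |hypCoeff a b c n| ≤ 1 * ((n : ℝ) + 1) ^ 0 := by
  have h1 := poch_pos ha n
  have h2 := poch_pos hb n
  have h3 := poch_pos (hb.trans_le hbc) n
  have h4 : (0 : ℝ) < n.factorial := by positivity
  have h5 := poch_le_poch ha ha1 n
  rw [poch_one] at h5
  rw [hypCoeff, abs_of_nonneg (by positivity), pow_zero, mul_one, div_le_one (by positivity),
    mul_comm]
  gcongr
  exact poch_le_poch hb hbc n

/-- The Gauss hypergeometric function satisfies the hypergeometric equation on `(-1, 1)`. -/
lemma exists_derivs_hyp2F1 {a b c : ℝ} (ha : 0 < a) (ha1 : a ≤ 1) (hb : 0 < b) (hbc : b ≤ c) :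
    ∃ G' G'' : ℝ → ℝ, ∀ z : ℝ, |z| < 1 →
      HasDerivAt (hyp2F1 a b c) (G' z) z ∧ HasDerivAt G' (G'' z) z ∧
      z * (1 - z) * G'' z + (c - (a + b + 1) * z) * G' z - a * b * hyp2F1 a b c z = 0 := by
  have hu := abs_hypCoeff_le ha ha1 hb hbc
  have hu' := poly_bound_derivative_coeff hu
  have hu'' := poly_bound_derivative_coeff hu'
  refine ⟨_, _, fun z hz => ⟨hasDerivAt_tsum_mul_pow hu hz, hasDerivAt_tsum_mul_pow hu' hz, ?_⟩⟩
  have s0 := hasSum_mul_pow_of_poly_bound hu hz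
  have s1 := hasSum_mul_pow_of_poly_bound hu' hz
  have s2 := hasSum_mul_pow_of_poly_bound hu'' hz
  have t1 := hasSum_natCast_mul_pow (a := hypCoeff a b c) s1
  have t2 := hasSum_natCast_mul_pow (a := fun n => ((n : ℝ) + 1) * hypCoeff a b c (n + 1)) s2
  have t3 := hasSum_natCast_mul_pow (a := fun n => ((n : ℝ) - 1) * hypCoeff a b c n)
    ((congrArg (HasSum · _) (funext fun n => by push_cast; ring)).mp t2)
  have key := ((t2.sub t3).add ((s1.mul_left c).sub (t1.mul_left (a + b + 1)))).sub
    (s0.mul_left (a * b))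
  have hzero := key.unique (a₂ := 0) (by
    refine (congrArg (HasSum · 0) (funext fun n => ?_)).mpr hasSum_zero
    linear_combination z ^ n * hypCoeff_succ (a := a) (b := b) (hb.trans_le hbc) n)
  rw [show hyp2F1 a b c z = ∑' n, hypCoeff a b c n * z ^ n from rfl]
  linear_combination hzero

/-- for `α, β ∈ (0,1)`, `μ > 0`, `F_μ` is twice differentiable on `(1,2)`
and satisfies the hypergeometric differential equation of `₂F₁(α−μ,β−μ;α+β−μ;λ)` there. -/
theorem stmt3 (α β μ : ℝ) (hα : α ∈ Ioo (0 : ℝ) 1) (hβ : β ∈ Ioo (0 : ℝ) 1)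
    (hμ : 0 < μ) :
    (∀ x ∈ Ioo (1 : ℝ) 2, DifferentiableAt ℝ (Ffun α β μ) x ∧
      DifferentiableAt ℝ (deriv (Ffun α β μ)) x) ∧
    ∀ x ∈ Ioo (1 : ℝ) 2,
      x * (1 - x) * deriv (deriv (Ffun α β μ)) x
        + (α + β - μ - (α + β - 2 * μ + 1) * x) * deriv (Ffun α β μ) x
        - (α - μ) * (β - μ) * Ffun α β μ x = 0 := by
  obtain ⟨G', G'', hG⟩ := exists_derivs_hyp2F1 (c := μ + 1) hα.1 hα.2.le hβ.1
    (by linarith [hβ.2])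
  have habs : ∀ x ∈ Ioo (1 : ℝ) 2, |1 - x| < 1 := fun x hx =>
    abs_lt.mpr ⟨by linarith [hx.2], by linarith [hx.1]⟩
  have hsub : ∀ x : ℝ, HasDerivAt (fun y : ℝ => 1 - y) (-1) x := fun x => by
    simpa using (hasDerivAt_id x).const_sub 1
  have hpow : ∀ x ∈ Ioo (1 : ℝ) 2, ∀ p : ℝ,
      HasDerivAt (fun y : ℝ => (y - 1) ^ p) (p * (x - 1) ^ (p - 1)) x := fun x hx p => by
    simpa using ((hasDerivAt_id x).sub_const 1).rpow_const (p := p)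
      (Or.inl (sub_pos.mpr hx.1).ne')
  have h1 : ∀ x ∈ Ioo (1 : ℝ) 2, HasDerivAt (Ffun α β μ)
      ((x - 1) ^ (μ - 1) * hyp2F1 α β (μ + 1) (1 - x) - 1 / μ * (x - 1) ^ μ * G' (1 - x)) x := by
    intro x hx
    have hg := (hG _ (habs x hx)).1.comp x (hsub x)
    refine (((hpow x hx μ).const_mul (1 / μ)).mul hg).congr_deriv ?_
    simp only [Function.comp_apply]
    field_simp
    ring
  have h2 : ∀ x ∈ Ioo (1 : ℝ) 2, HasDerivAt (deriv (Ffun α β μ))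
      ((μ - 1) * (x - 1) ^ (μ - 1 - 1) * hyp2F1 α β (μ + 1) (1 - x)
        - 2 * (x - 1) ^ (μ - 1) * G' (1 - x) + 1 / μ * (x - 1) ^ μ * G'' (1 - x)) x := by
    intro x hx
    have hg := (hG _ (habs x hx)).1.comp x (hsub x)
    have hg' := (hG _ (habs x hx)).2.1.comp x (hsub x)
    have hd := ((hpow x hx (μ - 1)).mul hg).sub (((hpow x hx μ).const_mul (1 / μ)).mul hg')
    have heq : deriv (Ffun α β μ) =ᶠ[𝓝 x] fun x =>
        (x - 1) ^ (μ - 1) * hyp2F1 α β (μ + 1) (1 - x) - 1 / μ * (x - 1) ^ μ * G' (1 - x) := by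
      filter_upwards [isOpen_Ioo.mem_nhds hx] with y hy using (h1 y hy).deriv
    refine (hd.congr_of_eventuallyEq heq).congr_deriv ?_
    simp only [Function.comp_apply]
    field_simp
    ring
  refine ⟨fun x hx => ⟨(h1 x hx).differentiableAt, (h2 x hx).differentiableAt⟩, fun x hx => ?_⟩
  rw [(h2 x hx).deriv, (h1 x hx).deriv, Ffun]
  have hx0 : 0 < x - 1 := sub_pos.mpr hx.1
  have e1 : (x - 1) ^ (μ - 1) = (x - 1) ^ (μ - 1 - 1) * (x - 1) := by
    rw [Real.rpow_sub_one hx0.ne' (μ - 1), div_mul_cancel₀ _ hx0.ne']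
  have e2 : (x - 1) ^ μ = (x - 1) ^ (μ - 1 - 1) * (x - 1) ^ 2 := by
    rw [pow_two, ← mul_assoc, ← e1, Real.rpow_sub_one hx0.ne' μ, div_mul_cancel₀ _ hx0.ne']
  have ode := (hG _ (habs x hx)).2.2
  rw [e2, e1]
  field_simp
  linear_combination (x - 1) ^ (μ - 1 - 1) * (x - 1) ^ 2 * ode
end

section
/- Let α, β ∈ (0,1) and μ be real numbers, and let λ > 2 be real. Then both double integrals below converge and ∫₀¹∫₀¹ (λ−t)^{μ−1}·t^{1−α−β}·(1−ts)^{α−1}·s^{−β}·(1−s)^{−α} ds dt = (λ−1)^{μ−1}·∫₀¹∫₀¹ (1 − wv/(1−λ))^{μ−1}·(1−w)^{−α}·(1−v)^{−β} dw dv, where all powers of positive real numbers are real powers. -/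
open Set MeasureTheory

/-- The substitution `(t, s) ↦ ((1 - t) / (1 - ts), 1 - ts)` of the open unit square. -/
noncomputable def squareSubst (p : ℝ × ℝ) : ℝ × ℝ :=
  ((1 - p.1) / (1 - p.1 * p.2), 1 - p.1 * p.2)

/-- The Fréchet derivative of `squareSubst`. -/
noncomputable def fderivSquareSubst (p : ℝ × ℝ) : ℝ × ℝ →L[ℝ] ℝ × ℝ :=
  (Matrix.toLin (.finTwoProd ℝ) (.finTwoProd ℝ)
    !![(p.2 - 1) / (1 - p.1 * p.2) ^ 2, (1 - p.1) * p.1 / (1 - p.1 * p.2) ^ 2;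
      -p.2, -p.1]).toContinuousLinearMap

theorem hasFDerivAt_squareSubst {p : ℝ × ℝ} (hp : 1 - p.1 * p.2 ≠ 0) :
    HasFDerivAt squareSubst (fderivSquareSubst p) p := by
  have hden : HasFDerivAt (fun q : ℝ × ℝ => 1 - q.1 * q.2) _ p :=
    ((hasFDerivAt_fst (𝕜 := ℝ) (p := p)).mul
      (hasFDerivAt_snd (𝕜 := ℝ) (p := p))).const_sub 1
  have hnum : HasFDerivAt (fun q : ℝ × ℝ => 1 - q.1) _ p :=
    (hasFDerivAt_fst (𝕜 := ℝ) (p := p)).const_sub 1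
  unfold fderivSquareSubst
  rw [Matrix.toLin_finTwoProd_toContinuousLinearMap]
  have hinv := (hasDerivAt_inv hp).comp_hasFDerivAt p hden
  refine (HasFDerivAt.prodMk (hnum.mul hinv) hden).congr_fderiv ?_
  have hp' : 1 - p.2 * p.1 ≠ 0 := by rwa [mul_comm]
  ext <;> simp <;> field_simp <;> ring

theorem det_fderivSquareSubst {p : ℝ × ℝ} (hp : 1 - p.1 * p.2 ≠ 0) :
    (fderivSquareSubst p).det = p.1 / (1 - p.1 * p.2) := by
  unfold fderivSquareSubst
  simp only [LinearMap.det_toContinuousLinearMap, LinearMap.det_toLin, Matrix.det_fin_two_of]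
  have hp' : 1 - p.2 * p.1 ≠ 0 := by rwa [mul_comm]
  field_simp
  ring

theorem one_sub_mul_pos_of_mem_square {p : ℝ × ℝ} (hp : p ∈ Ioo (0 : ℝ) 1 ×ˢ Ioo (0 : ℝ) 1) :
    0 < 1 - p.1 * p.2 := by
  obtain ⟨⟨h1, h2⟩, h3, h4⟩ := hp
  nlinarith

theorem injOn_squareSubst : InjOn squareSubst (Ioo (0 : ℝ) 1 ×ˢ Ioo (0 : ℝ) 1) := by
  rintro ⟨t, s⟩ hp ⟨t', s'⟩ hp' h
  have hd := one_sub_mul_pos_of_mem_square hp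
  simp only [squareSubst, Prod.mk.injEq] at h hd
  obtain ⟨h1, h2⟩ := h
  rw [← h2, div_left_inj' hd.ne'] at h1
  have ht : t = t' := by linarith
  subst ht
  have hs : s = s' := mul_left_cancel₀ hp.1.1.ne' (by linarith)
  rw [hs]

theorem image_squareSubst :
    squareSubst '' (Ioo (0 : ℝ) 1 ×ˢ Ioo (0 : ℝ) 1) = Ioo (0 : ℝ) 1 ×ˢ Ioo (0 : ℝ) 1 := by
  ext ⟨w, v⟩
  constructor
  · rintro ⟨⟨t, s⟩, hp, h⟩
    have hd := one_sub_mul_pos_of_mem_square hp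
    obtain ⟨⟨h1, h2⟩, h3, h4⟩ := hp
    rw [← h]
    simp only [squareSubst] at h1 h2 h3 h4 hd ⊢
    refine ⟨⟨div_pos (by linarith) hd, (div_lt_one hd).2 (by nlinarith)⟩, hd, ?_⟩
    have := mul_pos h1 h3
    simp only
    linarith
  · intro hp
    have hd := one_sub_mul_pos_of_mem_square hp
    obtain ⟨⟨h1, h2⟩, h3, h4⟩ := hp
    simp only at h1 h2 h3 h4 hd
    have hwv := mul_pos h1 h3
    refine ⟨(1 - w * v, (1 - v) / (1 - w * v)),
      ⟨⟨hd, by simp only; linarith⟩,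
        div_pos (by linarith) hd, (div_lt_one hd).2 (by nlinarith)⟩, ?_⟩
    have hv : 1 - (1 - w * v) * ((1 - v) / (1 - w * v)) = v := by
      field_simp
      ring
    simp only [squareSubst, hv, Prod.mk.injEq, and_true]
    field_simp
    ring

theorem integrableOn_one_sub_rpow {r : ℝ} (hr : -1 < r) :
    IntegrableOn (fun x : ℝ => (1 - x) ^ r) (Ioo (0 : ℝ) 1) := by
  rw [← intervalIntegrable_iff_integrableOn_Ioo_of_le zero_le_one]
  simpa using ((intervalIntegral.intervalIntegrable_rpow' hr (a := 0) (b := 1)).comp_sub_left 1).symm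

theorem rpow_le_two_rpow_abs {x : ℝ} (h1 : 1 ≤ x) (h2 : x ≤ 2) (r : ℝ) :
    x ^ r ≤ 2 ^ |r| :=
  (Real.rpow_le_rpow_of_exponent_le h1 (le_abs_self r)).trans
    (Real.rpow_le_rpow (by linarith) h2 (abs_nonneg r))

theorem integrableOn_square_kernel {α β μ l : ℝ} (hα : α < 1) (hβ : β < 1) (hl : 2 < l) :
    IntegrableOn
      (fun p : ℝ × ℝ => (1 - p.1 * p.2 / (1 - l)) ^ (μ - 1) *
        (1 - p.1) ^ (-α) * (1 - p.2) ^ (-β))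
      (Ioo (0 : ℝ) 1 ×ˢ Ioo (0 : ℝ) 1) volume := by
  have hprod : IntegrableOn (fun p : ℝ × ℝ => (1 - p.1) ^ (-α) * (1 - p.2) ^ (-β))
      (Ioo (0 : ℝ) 1 ×ˢ Ioo (0 : ℝ) 1) volume := by
    rw [IntegrableOn, Measure.volume_eq_prod, ← Measure.prod_restrict]
    exact (integrableOn_one_sub_rpow (by linarith)).mul_prod
      (integrableOn_one_sub_rpow (by linarith))
  simp only [mul_assoc]
  refine hprod.bdd_mul (c := 2 ^ |μ - 1|) ?_ ?_
  · exact (by fun_prop : Measurable fun p : ℝ × ℝ =>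
      (1 - p.1 * p.2 / (1 - l)) ^ (μ - 1)).aestronglyMeasurable
  · refine ae_restrict_of_forall_mem (measurableSet_Ioo.prod measurableSet_Ioo) fun p hp => ?_
    have hd := one_sub_mul_pos_of_mem_square hp
    have hpos := mul_pos hp.1.1 hp.2.1
    have h0 : 0 ≤ p.1 * p.2 / (l - 1) := div_nonneg hpos.le (by linarith)
    have h1 : p.1 * p.2 / (l - 1) ≤ 1 := (div_le_one (by linarith)).2 (by linarith)
    have he : 1 - p.1 * p.2 / (1 - l) = 1 + p.1 * p.2 / (l - 1) := by
      rw [← neg_sub l 1, div_neg, sub_neg_eq_add]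
    rw [he, Real.norm_of_nonneg (Real.rpow_nonneg (by linarith) _)]
    exact rpow_le_two_rpow_abs (by linarith) (by linarith) _

theorem abs_det_smul_square_kernel {α β μ l : ℝ} (hl : 1 < l) {p : ℝ × ℝ}
    (hp : p ∈ Ioo (0 : ℝ) 1 ×ˢ Ioo (0 : ℝ) 1) :
    (l - p.1) ^ (μ - 1) * p.1 ^ (1 - α - β) *
        (1 - p.1 * p.2) ^ (α - 1) * p.2 ^ (-β) * (1 - p.2) ^ (-α) =
      (l - 1) ^ (μ - 1) * (|(fderivSquareSubst p).det| •
        ((1 - (squareSubst p).1 * (squareSubst p).2 / (1 - l)) ^ (μ - 1) *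
          (1 - (squareSubst p).1) ^ (-α) * (1 - (squareSubst p).2) ^ (-β))) := by
  have hd := one_sub_mul_pos_of_mem_square hp
  rw [det_fderivSquareSubst hd.ne', abs_of_pos (div_pos hp.1.1 hd)]
  obtain ⟨t, s⟩ := p
  obtain ⟨⟨h1, h2⟩, h3, h4⟩ := hp
  simp only [squareSubst, smul_eq_mul] at h1 h2 h3 h4 hd ⊢
  have hl1 : 1 - l ≠ 0 := by linarith
  have hl1' : l - 1 ≠ 0 := by linarith
  have e1 : 1 - (1 - t) / (1 - t * s) * (1 - t * s) / (1 - l) = (l - t) / (l - 1) := by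
    rw [div_mul_cancel₀ _ hd.ne']
    field_simp
    ring
  have e2 : 1 - (1 - t) / (1 - t * s) = t * (1 - s) / (1 - t * s) := by
    field_simp
    ring
  have e3 : 1 - (1 - t * s) = t * s := by ring
  have hs : 0 < 1 - s := by linarith
  rw [e1, e2, e3, Real.div_rpow (by linarith) (by linarith),
    Real.div_rpow (by positivity) hd.le, Real.mul_rpow h1.le hs.le, Real.mul_rpow h1.le h3.le,
    Real.rpow_neg hd.le, Real.rpow_sub_one hd.ne', show 1 - α - β = 1 + -α + -β by ring,
    Real.rpow_add h1, Real.rpow_add h1, Real.rpow_one]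
  have : (l - 1) ^ (μ - 1) ≠ 0 := (Real.rpow_pos_of_pos (by linarith) _).ne'
  field_simp

/-- for `α, β ∈ (0,1)`, `μ ∈ ℝ` and `λ > 2`, the two double integrals
converge and
`∫₀¹∫₀¹ (λ−t)^{μ−1} t^{1−α−β} (1−ts)^{α−1} s^{−β} (1−s)^{−α} ds dt
  = (λ−1)^{μ−1} ∫₀¹∫₀¹ (1−wv/(1−λ))^{μ−1} (1−w)^{−α} (1−v)^{−β} dw dv`. -/
theorem stmt11 (α β μ l : ℝ) (hα : α ∈ Ioo (0 : ℝ) 1) (hβ : β ∈ Ioo (0 : ℝ) 1)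
    (hl : 2 < l) :
    IntegrableOn
      (fun p : ℝ × ℝ => (l - p.1) ^ (μ - 1) * p.1 ^ (1 - α - β) *
        (1 - p.1 * p.2) ^ (α - 1) * p.2 ^ (-β) * (1 - p.2) ^ (-α))
      (Ioo (0 : ℝ) 1 ×ˢ Ioo (0 : ℝ) 1) volume ∧
    IntegrableOn
      (fun p : ℝ × ℝ => (1 - p.1 * p.2 / (1 - l)) ^ (μ - 1) *
        (1 - p.1) ^ (-α) * (1 - p.2) ^ (-β))
      (Ioo (0 : ℝ) 1 ×ˢ Ioo (0 : ℝ) 1) volume ∧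
    (∫ p in Ioo (0 : ℝ) 1 ×ˢ Ioo (0 : ℝ) 1,
        (l - p.1) ^ (μ - 1) * p.1 ^ (1 - α - β) *
          (1 - p.1 * p.2) ^ (α - 1) * p.2 ^ (-β) * (1 - p.2) ^ (-α))
      = (l - 1) ^ (μ - 1) *
        ∫ p in Ioo (0 : ℝ) 1 ×ˢ Ioo (0 : ℝ) 1,
          (1 - p.1 * p.2 / (1 - l)) ^ (μ - 1) * (1 - p.1) ^ (-α) * (1 - p.2) ^ (-β) := by
  have hS : MeasurableSet (Ioo (0 : ℝ) 1 ×ˢ Ioo (0 : ℝ) 1) :=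
    measurableSet_Ioo.prod measurableSet_Ioo
  have hderiv : ∀ p ∈ Ioo (0 : ℝ) 1 ×ˢ Ioo (0 : ℝ) 1, HasFDerivWithinAt squareSubst
      (fderivSquareSubst p) (Ioo (0 : ℝ) 1 ×ˢ Ioo (0 : ℝ) 1) p := fun p hp =>
    (hasFDerivAt_squareSubst (one_sub_mul_pos_of_mem_square hp).ne').hasFDerivWithinAt
  have hkernel := integrableOn_square_kernel (μ := μ) hα.2 hβ.2 hl
  refine ⟨?_, hkernel, ?_⟩
  · rw [integrableOn_congr_fun (fun p hp => abs_det_smul_square_kernel (by linarith) hp) hS]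
    rw [← image_squareSubst, integrableOn_image_iff_integrableOn_abs_det_fderiv_smul volume hS
      hderiv injOn_squareSubst] at hkernel
    exact hkernel.const_mul _
  · rw [setIntegral_congr_fun hS (fun p hp => abs_det_smul_square_kernel (by linarith) hp),
      integral_const_mul, ← integral_image_eq_integral_abs_det_fderiv_smul volume hS
      hderiv injOn_squareSubst (fun p : ℝ × ℝ => (1 - p.1 * p.2 / (1 - l)) ^ (μ - 1) *
        (1 - p.1) ^ (-α) * (1 - p.2) ^ (-β)), image_squareSubst]
end
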